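/- (Single-swap improvement lemma.) In the consensus regime, fix a player i and strategies s_{-i} of the other players. If s_i, s_i' ⊆ V are two strategies with |s_i'| = |s_i| and x_i(s_i', s_{-i}) > x_i(s_i, s_{-i}), then there exist nodes v ∈ s_i ∖ s_i' and u ∈ s_i' ∖ s_i such that the single-node swap s_i'' = (s_i ∖ {v}) ∪ {u} satisfies x_i(s_i'', s_{-i}) > x_i(s_i, s_{-i}). -/

import Mathlib

open Finset

/-- `seedCount s v` is `m_v(s)`, the number of players that include node `v`
in their seed set. -/
def seedCount {m n : ℕ} (s : Fin m → Finset (Fin n)) (v : Fin n) : ℕ :=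
  (Finset.univ.filter (fun j => v ∈ s j)).card

/-- `seeded s` is `V_s`, the set of nodes seeded by at least one player. -/
def seeded {m n : ℕ} (s : Fin m → Finset (Fin n)) : Finset (Fin n) :=
  Finset.univ.biUnion s

/-- The consensus opinion toward player `i`:
`x_i(s) = Σ_{v ∈ s_i} c^v / m_v(s) + ε · Σ_{v ∈ V ∖ V_s} c^v`. -/
noncomputable def consOp {m n : ℕ} (c : Fin n → ℝ) (ε : ℝ) (s : Fin m → Finset (Fin n))
    (i : Fin m) : ℝ :=
  (∑ v ∈ s i, c v / (seedCount s v : ℝ)) + ε * ∑ v ∈ Finset.univ \ seeded s, c v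

/-- Player `i`'s utility in the consensus regime: `π_i(s) = x_i(s) / (Σ_{j ∈ M} x_j(s))`. -/
noncomputable def consPayoff {m n : ℕ} (c : Fin n → ℝ) (ε : ℝ) (s : Fin m → Finset (Fin n))
    (i : Fin m) : ℝ :=
  consOp c ε s i / ∑ j : Fin m, consOp c ε s j

/-- The number of players other than `i` that seed `v`. -/
def othersCount {m n : ℕ} (s : Fin m → Finset (Fin n)) (i : Fin m) (v : Fin n) : ℕ :=
  (Finset.univ.filter (fun j => j ≠ i ∧ v ∈ s j)).card

/-- The marginal contribution of the node `v` to the consensus opinion toward player `i`. -/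
noncomputable def marginal {m n : ℕ} (c : Fin n → ℝ) (ε : ℝ) (s : Fin m → Finset (Fin n))
    (i : Fin m) (v : Fin n) : ℝ :=
  c v / (othersCount s i v + 1 : ℝ) - if othersCount s i v = 0 then ε * c v else 0

lemma seedCount_update_of_mem {m n : ℕ} (s : Fin m → Finset (Fin n)) (i : Fin m)
    {X : Finset (Fin n)} {v : Fin n} (hv : v ∈ X) :
    seedCount (Function.update s i X) v = othersCount s i v + 1 := by
  have h : (Finset.univ.filter fun j => v ∈ Function.update s i X j) =
      insert i (Finset.univ.filter fun j => j ≠ i ∧ v ∈ s j) := by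
    ext j
    by_cases hj : j = i
    · subst hj; simp [hv]
    · simp [hj]
  rw [seedCount, h, Finset.card_insert_of_notMem (by simp), othersCount]

lemma notMem_seeded_update {m n : ℕ} (s : Fin m → Finset (Fin n)) (i : Fin m)
    (X : Finset (Fin n)) (v : Fin n) :
    v ∉ seeded (Function.update s i X) ↔ v ∉ X ∧ othersCount s i v = 0 := by
  simp only [seeded, othersCount, Finset.mem_biUnion, Finset.mem_univ, true_and, not_exists,
    Finset.card_eq_zero, Finset.filter_eq_empty_iff, not_and, forall_const]
  constructor
  · intro h
    refine ⟨by simpa using h i, fun j hj => ?_⟩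
    simpa [hj] using h j
  · rintro ⟨hX, h⟩ j
    by_cases hj : j = i
    · subst hj; simpa using hX
    · simpa [hj] using h hj

lemma consOp_update {m n : ℕ} (c : Fin n → ℝ) (ε : ℝ) (s : Fin m → Finset (Fin n))
    (i : Fin m) (X : Finset (Fin n)) :
    consOp c ε (Function.update s i X) i =
      (∑ v : Fin n, if othersCount s i v = 0 then ε * c v else 0) +
        ∑ v ∈ X, marginal c ε s i v := by
  have h : Finset.univ \ seeded (Function.update s i X) =
      Finset.univ.filter fun v => v ∉ X ∧ othersCount s i v = 0 := by
    ext v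
    simpa using notMem_seeded_update s i X v
  rw [consOp, h, Function.update_self, ← Finset.sum_filter_add_sum_filter_not Finset.univ (· ∈ X)
    (fun v => if othersCount s i v = 0 then ε * c v else 0)]
  simp only [marginal, Finset.sum_sub_distrib, Finset.filter_univ_mem]
  have h₁ : ∑ v ∈ X, c v / (seedCount (Function.update s i X) v : ℝ) =
      ∑ v ∈ X, c v / (othersCount s i v + 1 : ℝ) :=
    Finset.sum_congr rfl fun v hv => by rw [seedCount_update_of_mem s i hv]; push_cast; rfl
  rw [h₁, Finset.mul_sum, ← Finset.filter_filter, Finset.sum_filter]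
  ring

/-- If `X` and `Y` have the same size and `Y` has the larger total weight, some element of
`Y \ X` outweighs some element of `X \ Y`. -/
lemma exists_lt_of_sum_lt_sum_of_card_eq {α : Type*} [DecidableEq α] (g : α → ℝ)
    {X Y : Finset α} (hcard : Y.card = X.card) (h : ∑ v ∈ X, g v < ∑ v ∈ Y, g v) :
    ∃ v ∈ X \ Y, ∃ u ∈ Y \ X, g v < g u := by
  have hc : (Y \ X).card = (X \ Y).card := Finset.card_sdiff_comm hcard
  have hlt : ∑ v ∈ X \ Y, g v < ∑ v ∈ Y \ X, g v := Finset.sum_sdiff_lt_sum_sdiff.2 h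
  by_contra! hle
  rcases (X \ Y).eq_empty_or_nonempty with he | hne
  · have he' : Y \ X = ∅ := by simpa [he] using hc
    simp [he, he'] at hlt
  · obtain ⟨v, hv, hmin⟩ := Finset.exists_min_image (X \ Y) g hne
    have h₁ := Finset.sum_le_card_nsmul (Y \ X) g (g v) (hle v hv)
    have h₂ := Finset.card_nsmul_le_sum (X \ Y) g (g v) hmin
    rw [hc] at h₁
    exact absurd hlt (not_lt.2 (h₁.trans h₂))

/-- Single-swap improvement lemma: in the consensus regime, with the other players'
strategies fixed, if a strategy `X'` of the same cardinality as `X` yields a strictly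
larger consensus opinion toward player `i`, then some single-node swap
`(X ∖ {v}) ∪ {u}` with `v ∈ X ∖ X'` and `u ∈ X' ∖ X` already does. -/
theorem consOp_single_swap (m n : ℕ) (hm : 2 ≤ m) (hn : 1 ≤ n)
    (c : Fin n → ℝ) (hc : ∀ v, 0 < c v) (hcsum : ∑ v : Fin n, c v = 1)
    (ε : ℝ) (hε : 0 < ε) (hε' : ε < 1 / (m : ℝ))
    (i : Fin m) (s : Fin m → Finset (Fin n))
    (X X' : Finset (Fin n)) (hcard : X'.card = X.card)
    (himp : consOp c ε (Function.update s i X) i < consOp c ε (Function.update s i X') i) :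
    ∃ v ∈ X \ X', ∃ u ∈ X' \ X,
      consOp c ε (Function.update s i X) i <
        consOp c ε (Function.update s i (insert u (X.erase v))) i := by
  rw [consOp_update, consOp_update] at himp
  obtain ⟨v, hv, u, hu, hvu⟩ :=
    exists_lt_of_sum_lt_sum_of_card_eq (marginal c ε s i) hcard (lt_of_add_lt_add_left himp)
  refine ⟨v, hv, u, hu, ?_⟩
  have hvX : v ∈ X := (Finset.mem_sdiff.1 hv).1
  have huX : u ∉ X.erase v := fun h => (Finset.mem_sdiff.1 hu).2 (Finset.mem_of_mem_erase h)
  rw [consOp_update, consOp_update, Finset.sum_insert huX, ← Finset.add_sum_erase X _ hvX]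
  linarith
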